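/- Let H be a 2-edge-connected spanning subgraph of a finite graph G with spanning tree T, let e be an edge of G not in H, let t be an edge of T, and let K = {f ∈ E(H) : f = t, or {t,f} is a cut pair of H}. Then any two distinct edges of K form a cut pair of H, and the number of cut pairs {f,f'} of H with f,f' ∈ K that are covered by e equals |K ∩ S_e| · (|K| − |K ∩ S_e|). -/

import Mathlib

open SimpleGraph

/-- A graph is `k`-edge-connected if it remains connected after the removal of any
set of fewer than `k` edges (i.e. any `k-1` edges). -/
def EdgeConnected {V : Type*} (G : SimpleGraph V) (k : ℕ) : Prop :=
  ∀ S : Set (Sym2 V), S.ncard < k → (G.deleteEdges S).Connected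

/-- `{e, f}` is a cut pair of `G`: both are edges, they are distinct, and removing
both disconnects `G`. -/
def CutPair {V : Type*} (G : SimpleGraph V) (e f : Sym2 V) : Prop :=
  e ∈ G.edgeSet ∧ f ∈ G.edgeSet ∧ e ≠ f ∧ ¬ (G.deleteEdges {e, f}).Connected

/-- `t ∈ S_e`: `t` lies on the unique path in the tree `T` between the endpoints of
the (non-tree) edge `e`. -/
def OnTreePath {V : Type*} (T : SimpleGraph V) (g t : Sym2 V) : Prop :=
  ∃ u v : V, g = s(u, v) ∧ ∀ p : T.Walk u v, p.IsPath → t ∈ p.edges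

/-- The two-colouring `c` of the vertices is crossed by exactly those edges of `G` that are equal to
one of `f`, `f'` but not to both. -/
def Separates {V : Type*} (G : SimpleGraph V) (f f' : Sym2 V) (c : V → Prop) : Prop :=
  ∀ x y, G.Adj x y → (¬ (c x ↔ c y) ↔ ¬ (s(x, y) = f ↔ s(x, y) = f'))

lemma SimpleGraph.Connected.iff_of_forall_adj {V : Type*} {G : SimpleGraph V} (hG : G.Connected)
    {c : V → Prop} (h : ∀ x y, G.Adj x y → (c x ↔ c y)) (x y : V) : c x ↔ c y := by
  obtain ⟨p⟩ := hG.preconnected x y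
  induction p with
  | nil => rfl
  | cons hadj _ ih => exact (h _ _ hadj).trans ih

lemma EdgeConnected.connected_deleteEdges_singleton {V : Type*} {G : SimpleGraph V}
    (hG : EdgeConnected G 2) (f : Sym2 V) : (G.deleteEdges {f}).Connected :=
  hG {f} (by simp)

lemma EdgeConnected.mono {V : Type*} {G G' : SimpleGraph V} {k : ℕ}
    (hG : EdgeConnected G k) (h : G ≤ G') : EdgeConnected G' k :=
  fun S hS => (hG S hS).mono (deleteEdges_mono h)

lemma EdgeConnected.connected {V : Type*} {G : SimpleGraph V} (hG : EdgeConnected G 2) :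
    G.Connected := by
  simpa using hG ∅ (by simp)

lemma CutPair.exists_separates {V : Type*} {G : SimpleGraph V} (hG : EdgeConnected G 2)
    {f f' : Sym2 V} (h : CutPair G f f') : ∃ c, Separates G f f' c := by
  obtain ⟨-, -, hne, hdis⟩ := h
  have : Nonempty V := hG.connected.nonempty
  have hpre : ¬ (G.deleteEdges {f, f'}).Preconnected := fun hp => hdis ⟨hp⟩
  simp only [Preconnected, not_forall] at hpre
  obtain ⟨u, v, huv⟩ := hpre
  refine ⟨fun x => (G.deleteEdges {f, f'}).Reachable u x, fun x y hxy => ?_⟩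
  have hout : ∀ x y, G.Adj x y → s(x, y) ≠ f → s(x, y) ≠ f' →
      ((G.deleteEdges {f, f'}).Reachable u x ↔ (G.deleteEdges {f, f'}).Reachable u y) := by
    intro x y hxy h1 h2
    have hadj : (G.deleteEdges {f, f'}).Adj x y := by simp [deleteEdges_adj, hxy, h1, h2]
    exact ⟨fun h => h.trans hadj.reachable, fun h => h.trans hadj.symm.reachable⟩
  have hcross : ∀ g, (g = f ∨ g = f') → s(x, y) = g →
      ¬ ((G.deleteEdges {f, f'}).Reachable u x ↔ (G.deleteEdges {f, f'}).Reachable u y) := by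
    intro g hg hxyg hiff
    obtain ⟨g', hg'⟩ : ∃ g', ∀ a, a ≠ g → a ≠ g' → a ≠ f ∧ a ≠ f' := by
      rcases hg with rfl | rfl
      · exact ⟨f', fun a h1 h2 => ⟨h1, h2⟩⟩
      · exact ⟨f, fun a h1 h2 => ⟨h2, h1⟩⟩
    refine huv (((hG.connected_deleteEdges_singleton g').iff_of_forall_adj
      (c := fun x => (G.deleteEdges {f, f'}).Reachable u x) (fun a b hab => ?_) u v).1 .rfl)
    rw [deleteEdges_adj, Set.mem_singleton_iff] at hab
    by_cases habg : s(a, b) = g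
    · rw [← hxyg, Sym2.eq_iff] at habg
      rcases habg with ⟨rfl, rfl⟩ | ⟨rfl, rfl⟩
      · exact hiff
      · exact hiff.symm
    · exact hout a b hab.1 (hg' _ habg hab.2).1 (hg' _ habg hab.2).2
  have := hout x y hxy
  have := hcross f (.inl rfl)
  have := hcross f' (.inr rfl)
  grind

lemma Separates.cutPair {V : Type*} {G : SimpleGraph V} {f f' : Sym2 V} {c : V → Prop}
    (h : Separates G f f' c) (hf : f ∈ G.edgeSet) (hf' : f' ∈ G.edgeSet) (hne : f ≠ f') :
    CutPair G f f' := by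
  refine ⟨hf, hf', hne, fun hcon => ?_⟩
  induction f with | _ x y
  refine (h x y hf).2 (by simpa using hne) (hcon.iff_of_forall_adj (fun a b hab => ?_) x y)
  rw [deleteEdges_adj, Set.mem_insert_iff, Set.mem_singleton_iff] at hab
  have := h a b hab.1
  tauto

lemma Separates.symmDiff {V : Type*} {G : SimpleGraph V} {t f f' : Sym2 V} {c c' : V → Prop}
    (h : Separates G t f c) (h' : Separates G t f' c') :
    Separates G f f' (fun x => (c x ↔ c' x)) := by
  intro x y hxy
  have := h x y hxy
  have := h' x y hxy
  tauto

lemma Separates.not_iff_walk {V : Type*} {H T : SimpleGraph V} (hTH : T ≤ H) {f f' : Sym2 V}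
    {c : V → Prop} (h : Separates H f f' c) {u v : V} (p : T.Walk u v) (hp : p.edges.Nodup) :
    ¬ (c u ↔ c v) ↔ ¬ (f ∈ p.edges ↔ f' ∈ p.edges) := by
  induction p with
  | nil => simp
  | @cons u w v hadj p ih =>
    rw [Walk.edges_cons, List.nodup_cons] at hp
    have := ih hp.2
    have := h u w (hTH hadj)
    have := hp.1
    simp only [Walk.edges_cons, List.mem_cons]
    grind

lemma Separates.cutPair_sup_edge_iff {V : Type*} {H : SimpleGraph V} (hH : EdgeConnected H 2)
    {f f' : Sym2 V} {c : V → Prop} (h : Separates H f f' c) (hf : f ∈ H.edgeSet)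
    (hf' : f' ∈ H.edgeSet) (hne : f ≠ f') {u v : V} (huv : u ≠ v) (he : s(u, v) ∉ H.edgeSet) :
    CutPair (H ⊔ fromEdgeSet {s(u, v)}) f f' ↔ (c u ↔ c v) := by
  have hle : H ≤ H ⊔ fromEdgeSet {s(u, v)} := le_sup_left
  have huf : s(u, v) ≠ f := fun h => he (h ▸ hf)
  have huf' : s(u, v) ≠ f' := fun h => he (h ▸ hf')
  constructor
  · intro hcut
    obtain ⟨c', hc'⟩ := hcut.exists_separates (hH.mono hle)
    have hadj : (H ⊔ fromEdgeSet {s(u, v)}).Adj u v := by simp [huv]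
    have huv' := hc' u v hadj
    have hagree : ∀ x y, H.Adj x y → ((c x ↔ c' x) ↔ (c y ↔ c' y)) := by
      intro x y hxy
      have h1 := (h x y hxy).trans (hc' x y (hle hxy)).symm
      clear * - h1
      tauto
    have hconst := hH.connected.iff_of_forall_adj (c := fun x => (c x ↔ c' x)) hagree u v
    have hc'uv : c' u ↔ c' v := by simpa [huf, huf'] using huv'
    clear * - hconst hc'uv
    tauto
  · intro hc
    refine Separates.cutPair (c := c) (fun x y hxy => ?_) (edgeSet_mono hle hf)
      (edgeSet_mono hle hf') hne
    rw [sup_adj, fromEdgeSet_adj, Set.mem_singleton_iff] at hxy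
    rcases hxy with hxy | ⟨hxy, -⟩
    · exact h x y hxy
    · rw [hxy]
      rw [Sym2.eq_iff] at hxy
      rcases hxy with ⟨rfl, rfl⟩ | ⟨rfl, rfl⟩ <;> tauto

lemma SimpleGraph.IsTree.onTreePath_iff {V : Type*} {T : SimpleGraph V} (hT : T.IsTree) {u v : V}
    (p : T.Walk u v) (hp : p.IsPath) (f : Sym2 V) : OnTreePath T s(u, v) f ↔ f ∈ p.edges := by
  constructor
  · rintro ⟨a, b, hab, h⟩
    rw [Sym2.eq_iff] at hab
    rcases hab with ⟨rfl, rfl⟩ | ⟨rfl, rfl⟩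
    · exact h p hp
    · simpa using h p.reverse hp.reverse
  · intro hf
    refine ⟨u, v, rfl, fun q hq => ?_⟩
    rwa [(hT.existsUnique_path u v).unique hq hp]

lemma Set.ncard_pairs_split {α : Type*} [Finite α] [DecidableEq α] (K A : Set α) :
    {p : Finset α | ∃ f f', p = {f, f'} ∧ f ∈ K ∧ f' ∈ K ∧ ¬ (f ∈ A ↔ f' ∈ A)}.ncard =
      (K ∩ A).ncard * (K.ncard - (K ∩ A).ncard) := by
  have himage : {p : Finset α | ∃ f f', p = {f, f'} ∧ f ∈ K ∧ f' ∈ K ∧ ¬ (f ∈ A ↔ f' ∈ A)} =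
      (fun q : α × α => ({q.1, q.2} : Finset α)) '' ((K ∩ A) ×ˢ (K \ A)) := by
    ext p
    constructor
    · rintro ⟨f, f', rfl, hf, hf', hA⟩
      by_cases hfA : f ∈ A
      · exact ⟨(f, f'), ⟨⟨hf, hfA⟩, hf', by tauto⟩, rfl⟩
      · exact ⟨(f', f), ⟨⟨hf', by tauto⟩, hf, hfA⟩, Finset.pair_comm _ _⟩
    · rintro ⟨⟨f, f'⟩, ⟨⟨hf, hfA⟩, hf', hfA'⟩, rfl⟩
      exact ⟨f, f', rfl, hf, hf', by tauto⟩
  rw [himage, Set.InjOn.ncard_image, Set.ncard_prod]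
  · congr 1
    have := Set.ncard_inter_add_ncard_sdiff_eq_ncard K A (Set.toFinite K)
    omega
  · rintro ⟨a, b⟩ ⟨⟨-, ha⟩, -, hb⟩ ⟨a', b'⟩ ⟨⟨-, ha'⟩, -, hb'⟩ h
    simp only [Finset.ext_iff, Finset.mem_insert, Finset.mem_singleton] at h ha hb ha' hb' ⊢
    have h1 := (h a).1 (.inl rfl)
    have h2 := (h b).1 (.inr rfl)
    grind

theorem stmt_6 {V : Type*} [Fintype V] [DecidableEq V]
    (G H : SimpleGraph V) (hHG : H ≤ G) (hH : EdgeConnected H 2)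
    (T : SimpleGraph V) (hTH : T ≤ H) (hT : T.IsTree)
    (e : Sym2 V) (heG : e ∈ G.edgeSet) (heH : e ∉ H.edgeSet)
    (t : Sym2 V) (ht : t ∈ T.edgeSet)
    (K : Set (Sym2 V))
    (hK : K = {f | f ∈ H.edgeSet ∧ (f = t ∨ CutPair H t f)}) :
    (∀ f ∈ K, ∀ f' ∈ K, f ≠ f' → CutPair H f f') ∧
    {p : Finset (Sym2 V) | ∃ f f', p = {f, f'} ∧ f ∈ K ∧ f' ∈ K ∧ f ≠ f' ∧
        ¬ CutPair (H ⊔ fromEdgeSet {e}) f f'}.ncard =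
      (K ∩ {f | OnTreePath T e f}).ncard *
        (K.ncard - (K ∩ {f | OnTreePath T e f}).ncard) := by
  have hsep : ∀ f ∈ K, ∃ c, Separates H t f c := by
    intro f hf
    rw [hK] at hf
    rcases hf.2 with rfl | hcut
    · exact ⟨fun _ => True, fun x y _ => by simp⟩
    · exact hcut.exists_separates hH
  have hmem : ∀ f ∈ K, f ∈ H.edgeSet := fun f hf => by
    rw [hK] at hf
    exact hf.1
  have hpair : ∀ f ∈ K, ∀ f' ∈ K, ∃ c, Separates H f f' c := by
    intro f hf f' hf'
    obtain ⟨c, hc⟩ := hsep f hf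
    obtain ⟨c', hc'⟩ := hsep f' hf'
    exact ⟨_, hc.symmDiff hc'⟩
  constructor
  · intro f hf f' hf' hne
    obtain ⟨c, hc⟩ := hpair f hf f' hf'
    exact hc.cutPair (hmem f hf) (hmem f' hf') hne
  · rw [← Set.ncard_pairs_split]
    congr 1
    ext P
    refine exists_congr fun f => exists_congr fun f' => and_congr_right fun _ =>
      and_congr_right fun hf => and_congr_right fun hf' => ?_
    by_cases hne : f = f'
    · simp [hne]
    obtain ⟨c, hc⟩ := hpair f hf f' hf'
    induction e with | _ u v
    obtain ⟨p, hp, -⟩ := hT.existsUnique_path u v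
    have huv : u ≠ v := G.ne_of_adj heG
    rw [hc.cutPair_sup_edge_iff hH (hmem f hf) (hmem f' hf') hne huv heH,
      hc.not_iff_walk hTH p hp.isTrail.edges_nodup, Set.mem_ofPred_eq, Set.mem_ofPred_eq,
      hT.onTreePath_iff p hp, hT.onTreePath_iff p hp]
    exact and_iff_right hne
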